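/- Let (φ_ε)_{ε∈(0,1]}, (ω_ε)_{ε∈(0,1]} ∈ M_Φ(Ω×ℝ^p) with (φ_ε − ω_ε)_ε negligible in S^1_hg(Ω×ℝ^p∖0), and set φ_{φ_ε}(y,ξ) := |∇_{y,ξ}φ_ε(y,ξ/|ξ|)|^{−2} and φ_{ω_ε}(y,ξ) := |∇_{y,ξ}ω_ε(y,ξ/|ξ|)|^{−2}. Then for every j = 1,…,p the net ((∂_{ξ_j}φ_ε) φ_{φ_ε} − (∂_{ξ_j}ω_ε) φ_{ω_ε})_ε is negligible in S^0_hg(Ω×ℝ^p∖0), and for every k = 1,…,n the net (|ξ|^{−2}((∂_{y_k}φ_ε) φ_{φ_ε} − (∂_{y_k}ω_ε) φ_{ω_ε}))_ε is negligible in S^{−1}_hg(Ω×ℝ^p∖0). -/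

import Mathlib

open MeasureTheory Set
open scoped BigOperators Topology Real

noncomputable section

/-- `Euc d` is `d`-dimensional Euclidean space. -/
abbrev Euc (d : ℕ) : Type := EuclideanSpace ℝ (Fin d)

/-- Directional derivative of `f` in direction `v`. -/
def dirD {E F : Type*} [NormedAddCommGroup E] [NormedSpace ℝ E]
    [NormedAddCommGroup F] [NormedSpace ℝ F] (v : E) (f : E → F) : E → F :=
  fun x => fderiv ℝ f x v

/-- Iterated directional derivatives along a list of directions. -/
def dirDs {E F : Type*} [NormedAddCommGroup E] [NormedSpace ℝ E]
    [NormedAddCommGroup F] [NormedSpace ℝ F] (L : List E) (f : E → F) : E → F :=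
  L.foldr dirD f

/-- ⟨ξ⟩ = (1+|ξ|²)^{1/2}. -/
def jb {d : ℕ} (ξ : Euc d) : ℝ := Real.sqrt (1 + ‖ξ‖ ^ 2)

/-- Basis direction in the first (`y`) block. -/
def eY {n p : ℕ} (k : Fin n) : Euc n × Euc p := (EuclideanSpace.single k 1, 0)

/-- Basis direction in the second (`ξ`) block. -/
def eXi {n p : ℕ} (j : Fin p) : Euc n × Euc p := (0, EuclideanSpace.single j 1)

def eX3 {q n p : ℕ} (i : Fin q) : Euc q × Euc n × Euc p := (EuclideanSpace.single i 1, 0, 0)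
def eY3 {q n p : ℕ} (k : Fin n) : Euc q × Euc n × Euc p := (0, EuclideanSpace.single k 1, 0)
def eXi3 {q n p : ℕ} (j : Fin p) : Euc q × Euc n × Euc p := (0, 0, EuclideanSpace.single j 1)

/-- basis directions of `Euc d` indexed by a list of coordinates -/
def basisL {d : ℕ} (L : List (Fin d)) : List (Euc d) :=
  L.map (fun i => EuclideanSpace.single i 1)

/-- |∇_{y,ξ}φ|² as a sum of squares of partial derivatives. -/
def gradSq {n p : ℕ} (φ : Euc n × Euc p → ℝ) (z : Euc n × Euc p) : ℝ :=
  (∑ k : Fin n, (dirD (eY k) φ z) ^ 2) + ∑ j : Fin p, (dirD (eXi j) φ z) ^ 2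

/-- |∇_ξ φ|². -/
def gradXiSq {n p : ℕ} (φ : Euc n × Euc p → ℝ) (z : Euc n × Euc p) : ℝ :=
  ∑ j : Fin p, (dirD (eXi j) φ z) ^ 2

/-- ∇_y φ as a vector in `Euc n`. -/
def gradY {n p : ℕ} (φ : Euc n × Euc p → ℝ) (z : Euc n × Euc p) : Euc n :=
  (EuclideanSpace.equiv (Fin n) ℝ).symm (fun k => dirD (eY k) φ z)

/-- |∇_{y,ξ}φ|² in the three-block setting (gradient w.r.t. `(y,ξ)` only). -/
def gradSq3 {q n p : ℕ} (φ : Euc q × Euc n × Euc p → ℝ) (z : Euc q × Euc n × Euc p) : ℝ :=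
  (∑ k : Fin n, (dirD (eY3 k) φ z) ^ 2) + ∑ j : Fin p, (dirD (eXi3 j) φ z) ^ 2

/-- slow scale net -/
def SlowScale (s : ℝ → ℝ) : Prop :=
  (∀ ε ∈ Set.Ioc (0:ℝ) 1, 0 < s ε) ∧
  ∀ q : ℕ, ∃ c > 0, ∀ ε ∈ Set.Ioc (0:ℝ) 1, s ε ^ q ≤ c / ε

/-- Moderate net in S^m_{ρ,δ}(Ω×ℝ^p): smoothness, membership, moderate bounds. -/
def SymbModerate {n p : ℕ} (Ω : Set (Euc n)) (m ρ δ : ℝ)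
    (a : ℝ → Euc n × Euc p → ℂ) : Prop :=
  (∀ ε ∈ Set.Ioc (0:ℝ) 1, ContDiffOn ℝ (⊤ : ℕ∞) (a ε) (Ω ×ˢ (univ : Set (Euc p)))) ∧
  (∀ ε ∈ Set.Ioc (0:ℝ) 1, ∀ K ⊆ Ω, IsCompact K → ∀ (α : List (Fin p)) (β : List (Fin n)),
    ∃ C : ℝ, ∀ y ∈ K, ∀ ξ : Euc p,
      jb ξ ^ (-m + ρ * (α.length : ℝ) - δ * (β.length : ℝ)) *
        ‖dirDs (α.map eXi ++ β.map eY) (a ε) (y, ξ)‖ ≤ C) ∧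
  ∀ K ⊆ Ω, IsCompact K → ∀ (α : List (Fin p)) (β : List (Fin n)),
    ∃ N : ℕ, ∃ C > 0, ∃ η ∈ Set.Ioc (0:ℝ) 1, ∀ ε ∈ Set.Ioc (0:ℝ) η, ∀ y ∈ K, ∀ ξ : Euc p,
      jb ξ ^ (-m + ρ * (α.length : ℝ) - δ * (β.length : ℝ)) *
        ‖dirDs (α.map eXi ++ β.map eY) (a ε) (y, ξ)‖ ≤ C * ε ^ (-(N : ℤ))

/-- Negligible net in S^m_{ρ,δ}(Ω×ℝ^p). -/
def SymbNegligible {n p : ℕ} (Ω : Set (Euc n)) (m ρ δ : ℝ)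
    (a : ℝ → Euc n × Euc p → ℂ) : Prop :=
  (∀ ε ∈ Set.Ioc (0:ℝ) 1, ContDiffOn ℝ (⊤ : ℕ∞) (a ε) (Ω ×ˢ (univ : Set (Euc p)))) ∧
  (∀ ε ∈ Set.Ioc (0:ℝ) 1, ∀ K ⊆ Ω, IsCompact K → ∀ (α : List (Fin p)) (β : List (Fin n)),
    ∃ C : ℝ, ∀ y ∈ K, ∀ ξ : Euc p,
      jb ξ ^ (-m + ρ * (α.length : ℝ) - δ * (β.length : ℝ)) *
        ‖dirDs (α.map eXi ++ β.map eY) (a ε) (y, ξ)‖ ≤ C) ∧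
  ∀ K ⊆ Ω, IsCompact K → ∀ (α : List (Fin p)) (β : List (Fin n)), ∀ q : ℕ,
    ∃ C > 0, ∃ η ∈ Set.Ioc (0:ℝ) 1, ∀ ε ∈ Set.Ioc (0:ℝ) η, ∀ y ∈ K, ∀ ξ : Euc p,
      jb ξ ^ (-m + ρ * (α.length : ℝ) - δ * (β.length : ℝ)) *
        ‖dirDs (α.map eXi ++ β.map eY) (a ε) (y, ξ)‖ ≤ C * ε ^ q

/-- Regular net in S^m_{ρ,δ}(Ω×ℝ^p): one N works for all derivatives on each compact set. -/
def SymbRegular {n p : ℕ} (Ω : Set (Euc n)) (m ρ δ : ℝ)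
    (a : ℝ → Euc n × Euc p → ℂ) : Prop :=
  (∀ ε ∈ Set.Ioc (0:ℝ) 1, ContDiffOn ℝ (⊤ : ℕ∞) (a ε) (Ω ×ˢ (univ : Set (Euc p)))) ∧
  (∀ ε ∈ Set.Ioc (0:ℝ) 1, ∀ K ⊆ Ω, IsCompact K → ∀ (α : List (Fin p)) (β : List (Fin n)),
    ∃ C : ℝ, ∀ y ∈ K, ∀ ξ : Euc p,
      jb ξ ^ (-m + ρ * (α.length : ℝ) - δ * (β.length : ℝ)) *
        ‖dirDs (α.map eXi ++ β.map eY) (a ε) (y, ξ)‖ ≤ C) ∧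
  ∀ K ⊆ Ω, IsCompact K → ∃ N : ℕ, ∀ (α : List (Fin p)) (β : List (Fin n)),
    ∃ C > 0, ∃ η ∈ Set.Ioc (0:ℝ) 1, ∀ ε ∈ Set.Ioc (0:ℝ) η, ∀ y ∈ K, ∀ ξ : Euc p,
      jb ξ ^ (-m + ρ * (α.length : ℝ) - δ * (β.length : ℝ)) *
        ‖dirDs (α.map eXi ++ β.map eY) (a ε) (y, ξ)‖ ≤ C * ε ^ (-(N : ℤ))

/-- Moderate net in S^m_hg(Ω×ℝ^p∖0) (F-valued, positively homogeneous symbols). -/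
def HgModerate {n p : ℕ} {F : Type*} [NormedAddCommGroup F] [NormedSpace ℝ F]
    (Ω : Set (Euc n)) (m : ℝ) (φ : ℝ → Euc n × Euc p → F) : Prop :=
  ∀ K ⊆ Ω, IsCompact K → ∀ (α : List (Fin p)) (β : List (Fin n)),
    ∃ N : ℕ, ∃ C > 0, ∃ η ∈ Set.Ioc (0:ℝ) 1, ∀ ε ∈ Set.Ioc (0:ℝ) η, ∀ y ∈ K,
      ∀ ξ : Euc p, ξ ≠ 0 →
      ‖ξ‖ ^ (-m + (α.length : ℝ)) *
        ‖dirDs (α.map eXi ++ β.map eY) (φ ε) (y, ξ)‖ ≤ C * ε ^ (-(N : ℤ))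

/-- Negligible net in S^m_hg(Ω×ℝ^p∖0). -/
def HgNegligible {n p : ℕ} {F : Type*} [NormedAddCommGroup F] [NormedSpace ℝ F]
    (Ω : Set (Euc n)) (m : ℝ) (φ : ℝ → Euc n × Euc p → F) : Prop :=
  ∀ K ⊆ Ω, IsCompact K → ∀ (α : List (Fin p)) (β : List (Fin n)), ∀ q : ℕ,
    ∃ C > 0, ∃ η ∈ Set.Ioc (0:ℝ) 1, ∀ ε ∈ Set.Ioc (0:ℝ) η, ∀ y ∈ K,
      ∀ ξ : Euc p, ξ ≠ 0 →
      ‖ξ‖ ^ (-m + (α.length : ℝ)) *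
        ‖dirDs (α.map eXi ++ β.map eY) (φ ε) (y, ξ)‖ ≤ C * ε ^ q

/-- Net of phase functions on Ω×ℝ^p. -/
def IsPhaseNet {n p : ℕ} (Ω : Set (Euc n)) (φ : ℝ → Euc n × Euc p → ℝ) : Prop :=
  ∀ ε ∈ Set.Ioc (0:ℝ) 1,
    ContDiffOn ℝ (⊤ : ℕ∞) (φ ε) (Ω ×ˢ {ξ : Euc p | ξ ≠ 0}) ∧
    (∀ y ∈ Ω, ∀ ξ : Euc p, ξ ≠ 0 → ∀ t : ℝ, 0 < t → φ ε (y, t • ξ) = t * φ ε (y, ξ)) ∧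
    (∀ y ∈ Ω, ∀ ξ : Euc p, ξ ≠ 0 → gradSq (φ ε) (y, ξ) ≠ 0)

/-- The set M_Φ(Ω×ℝ^p) of moderate nets of phase functions with strictly nonzero gradient. -/
def MPhi {n p : ℕ} (Ω : Set (Euc n)) (φ : ℝ → Euc n × Euc p → ℝ) : Prop :=
  IsPhaseNet Ω φ ∧ HgModerate Ω 1 φ ∧
  ∀ K ⊆ Ω, IsCompact K → ∃ r > (0:ℝ), ∃ η ∈ Set.Ioc (0:ℝ) 1, ∀ ε ∈ Set.Ioc (0:ℝ) η,
    ∀ y ∈ K, ∀ ξ : Euc p, ξ ≠ 0 → ε ^ r ≤ gradSq (φ ε) (y, ‖ξ‖⁻¹ • ξ)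

/-- Slow scale moderateness in S^m_hg. -/
def HgSlowScale {n p : ℕ} {F : Type*} [NormedAddCommGroup F] [NormedSpace ℝ F]
    (Ω : Set (Euc n)) (m : ℝ) (φ : ℝ → Euc n × Euc p → F) : Prop :=
  ∀ K ⊆ Ω, IsCompact K → ∀ (α : List (Fin p)) (β : List (Fin n)),
    ∃ s : ℝ → ℝ, SlowScale s ∧ ∃ η ∈ Set.Ioc (0:ℝ) 1, ∀ ε ∈ Set.Ioc (0:ℝ) η, ∀ y ∈ K,
      ∀ ξ : Euc p, ξ ≠ 0 →
      ‖ξ‖ ^ (-m + (α.length : ℝ)) *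
        ‖dirDs (α.map eXi ++ β.map eY) (φ ε) (y, ξ)‖ ≤ s ε

/-- Slow scale nets of phase functions M_{Φ,sc}(Ω×ℝ^p). -/
def MPhiSc {n p : ℕ} (Ω : Set (Euc n)) (φ : ℝ → Euc n × Euc p → ℝ) : Prop :=
  IsPhaseNet Ω φ ∧ HgSlowScale Ω 1 φ ∧
  ∀ K ⊆ Ω, IsCompact K → ∃ s : ℝ → ℝ, SlowScale s ∧ ∃ η ∈ Set.Ioc (0:ℝ) 1,
    ∀ ε ∈ Set.Ioc (0:ℝ) η, ∀ y ∈ K, ∀ ξ : Euc p, ξ ≠ 0 →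
      (s ε)⁻¹ ≤ gradSq (φ ε) (y, ‖ξ‖⁻¹ • ξ)

/-- cut-off function equal to 1 for |ξ|<1/4 and 0 for |ξ|>1/2. -/
def IsCutoff {p : ℕ} (χ : Euc p → ℝ) : Prop :=
  ContDiff ℝ (⊤ : ℕ∞) χ ∧ (∀ ξ : Euc p, ‖ξ‖ < 1/4 → χ ξ = 1) ∧ (∀ ξ : Euc p, 1/2 < ‖ξ‖ → χ ξ = 0)

/-- 1/|∇_{y,ξ}φ(y,ξ/|ξ|)|². -/
def varphiN {n p : ℕ} (φ : Euc n × Euc p → ℝ) (z : Euc n × Euc p) : ℝ :=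
  (gradSq φ (z.1, ‖z.2‖⁻¹ • z.2))⁻¹

def coefA {n p : ℕ} (χ : Euc p → ℝ) (φ : Euc n × Euc p → ℝ) (j : Fin p) :
    Euc n × Euc p → ℂ :=
  fun z => Complex.I * (((1 - χ z.2) * varphiN φ z * dirD (eXi j) φ z : ℝ) : ℂ)

def coefB {n p : ℕ} (χ : Euc p → ℝ) (φ : Euc n × Euc p → ℝ) (k : Fin n) :
    Euc n × Euc p → ℂ :=
  fun z => Complex.I * (((1 - χ z.2) * (‖z.2‖ ^ 2)⁻¹ * varphiN φ z * dirD (eY k) φ z : ℝ) : ℂ)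

def coefC {n p : ℕ} (χ : Euc p → ℝ) (φ : Euc n × Euc p → ℝ) : Euc n × Euc p → ℂ :=
  fun z => ((χ z.2 : ℝ) : ℂ) + (∑ j : Fin p, dirD (eXi j) (coefA χ φ j) z)
    + ∑ k : Fin n, dirD (eY k) (coefB χ φ k) z

/-- The operator L_φ. -/
def Lop {n p : ℕ} (χ : Euc p → ℝ) (φ : Euc n × Euc p → ℝ) (f : Euc n × Euc p → ℂ) :
    Euc n × Euc p → ℂ :=
  fun z => (∑ j : Fin p, coefA χ φ j z * dirD (eXi j) f z)
    + (∑ k : Fin n, coefB χ φ k z * dirD (eY k) f z) + coefC χ φ z * f z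

/-- Moderate nets of smooth functions E_M(Ω). -/
def EMod {d : ℕ} (Ω : Set (Euc d)) (v : ℝ → Euc d → ℂ) : Prop :=
  (∀ ε ∈ Set.Ioc (0:ℝ) 1, ContDiffOn ℝ (⊤ : ℕ∞) (v ε) Ω) ∧
  ∀ K ⊆ Ω, IsCompact K → ∀ L : List (Fin d),
    ∃ N : ℕ, ∃ C > 0, ∃ η ∈ Set.Ioc (0:ℝ) 1, ∀ ε ∈ Set.Ioc (0:ℝ) η, ∀ x ∈ K,
      ‖dirDs (basisL L) (v ε) x‖ ≤ C * ε ^ (-(N : ℤ))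

/-- Regular nets of smooth functions E^∞_M(Ω). -/
def EModInf {d : ℕ} (Ω : Set (Euc d)) (v : ℝ → Euc d → ℂ) : Prop :=
  (∀ ε ∈ Set.Ioc (0:ℝ) 1, ContDiffOn ℝ (⊤ : ℕ∞) (v ε) Ω) ∧
  ∀ K ⊆ Ω, IsCompact K → ∃ N : ℕ, ∀ L : List (Fin d),
    ∃ C > 0, ∃ η ∈ Set.Ioc (0:ℝ) 1, ∀ ε ∈ Set.Ioc (0:ℝ) η, ∀ x ∈ K,
      ‖dirDs (basisL L) (v ε) x‖ ≤ C * ε ^ (-(N : ℤ))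

/-- Moderate net in S^m_{ρ,δ}(Ω'×Ω×ℝ^p). -/
def Symb3Moderate {q n p : ℕ} (Ω' : Set (Euc q)) (Ω : Set (Euc n)) (m ρ δ : ℝ)
    (a : ℝ → Euc q × Euc n × Euc p → ℂ) : Prop :=
  (∀ ε ∈ Set.Ioc (0:ℝ) 1, ContDiffOn ℝ (⊤ : ℕ∞) (a ε) (Ω' ×ˢ Ω ×ˢ (univ : Set (Euc p)))) ∧
  (∀ ε ∈ Set.Ioc (0:ℝ) 1, ∀ K' ⊆ Ω', IsCompact K' → ∀ K ⊆ Ω, IsCompact K →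
    ∀ (α : List (Fin p)) (βx : List (Fin q)) (βy : List (Fin n)),
    ∃ C : ℝ, ∀ x ∈ K', ∀ y ∈ K, ∀ ξ : Euc p,
      jb ξ ^ (-m + ρ * (α.length : ℝ) - δ * ((βx.length + βy.length : ℕ) : ℝ)) *
        ‖dirDs (α.map eXi3 ++ βx.map eX3 ++ βy.map eY3) (a ε) (x, y, ξ)‖ ≤ C) ∧
  ∀ K' ⊆ Ω', IsCompact K' → ∀ K ⊆ Ω, IsCompact K →
    ∀ (α : List (Fin p)) (βx : List (Fin q)) (βy : List (Fin n)),
    ∃ N : ℕ, ∃ C > 0, ∃ η ∈ Set.Ioc (0:ℝ) 1, ∀ ε ∈ Set.Ioc (0:ℝ) η,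
      ∀ x ∈ K', ∀ y ∈ K, ∀ ξ : Euc p,
      jb ξ ^ (-m + ρ * (α.length : ℝ) - δ * ((βx.length + βy.length : ℕ) : ℝ)) *
        ‖dirDs (α.map eXi3 ++ βx.map eX3 ++ βy.map eY3) (a ε) (x, y, ξ)‖ ≤ C * ε ^ (-(N : ℤ))

/-- Regular net in S^m_{ρ,δ}(Ω'×Ω×ℝ^p). -/
def Symb3Regular {q n p : ℕ} (Ω' : Set (Euc q)) (Ω : Set (Euc n)) (m ρ δ : ℝ)
    (a : ℝ → Euc q × Euc n × Euc p → ℂ) : Prop :=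
  (∀ ε ∈ Set.Ioc (0:ℝ) 1, ContDiffOn ℝ (⊤ : ℕ∞) (a ε) (Ω' ×ˢ Ω ×ˢ (univ : Set (Euc p)))) ∧
  (∀ ε ∈ Set.Ioc (0:ℝ) 1, ∀ K' ⊆ Ω', IsCompact K' → ∀ K ⊆ Ω, IsCompact K →
    ∀ (α : List (Fin p)) (βx : List (Fin q)) (βy : List (Fin n)),
    ∃ C : ℝ, ∀ x ∈ K', ∀ y ∈ K, ∀ ξ : Euc p,
      jb ξ ^ (-m + ρ * (α.length : ℝ) - δ * ((βx.length + βy.length : ℕ) : ℝ)) *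
        ‖dirDs (α.map eXi3 ++ βx.map eX3 ++ βy.map eY3) (a ε) (x, y, ξ)‖ ≤ C) ∧
  ∀ K' ⊆ Ω', IsCompact K' → ∀ K ⊆ Ω, IsCompact K → ∃ N : ℕ,
    ∀ (α : List (Fin p)) (βx : List (Fin q)) (βy : List (Fin n)),
    ∃ C > 0, ∃ η ∈ Set.Ioc (0:ℝ) 1, ∀ ε ∈ Set.Ioc (0:ℝ) η,
      ∀ x ∈ K', ∀ y ∈ K, ∀ ξ : Euc p,
      jb ξ ^ (-m + ρ * (α.length : ℝ) - δ * ((βx.length + βy.length : ℕ) : ℝ)) *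
        ‖dirDs (α.map eXi3 ++ βx.map eX3 ++ βy.map eY3) (a ε) (x, y, ξ)‖ ≤ C * ε ^ (-(N : ℤ))

/-- Moderate net of order −∞ on Ω'×Ω×ℝ^p. -/
def Smoothing3Moderate {q n p : ℕ} (Ω' : Set (Euc q)) (Ω : Set (Euc n))
    (a : ℝ → Euc q × Euc n × Euc p → ℂ) : Prop :=
  (∀ ε ∈ Set.Ioc (0:ℝ) 1, ContDiffOn ℝ (⊤ : ℕ∞) (a ε) (Ω' ×ˢ Ω ×ˢ (univ : Set (Euc p)))) ∧
  (∀ ε ∈ Set.Ioc (0:ℝ) 1, ∀ m : ℝ, ∀ K' ⊆ Ω', IsCompact K' → ∀ K ⊆ Ω, IsCompact K →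
    ∀ (α : List (Fin p)) (βx : List (Fin q)) (βy : List (Fin n)),
    ∃ C : ℝ, ∀ x ∈ K', ∀ y ∈ K, ∀ ξ : Euc p,
      jb ξ ^ (-m + (α.length : ℝ)) *
        ‖dirDs (α.map eXi3 ++ βx.map eX3 ++ βy.map eY3) (a ε) (x, y, ξ)‖ ≤ C) ∧
  ∀ m : ℝ, ∀ K' ⊆ Ω', IsCompact K' → ∀ K ⊆ Ω, IsCompact K →
    ∀ (α : List (Fin p)) (βx : List (Fin q)) (βy : List (Fin n)),
    ∃ N : ℕ, ∃ C > 0, ∃ η ∈ Set.Ioc (0:ℝ) 1, ∀ ε ∈ Set.Ioc (0:ℝ) η,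
      ∀ x ∈ K', ∀ y ∈ K, ∀ ξ : Euc p,
      jb ξ ^ (-m + (α.length : ℝ)) *
        ‖dirDs (α.map eXi3 ++ βx.map eX3 ++ βy.map eY3) (a ε) (x, y, ξ)‖ ≤ C * ε ^ (-(N : ℤ))

/-- Regular net of order −∞ on Ω'×Ω×ℝ^p. -/
def Smoothing3Regular {q n p : ℕ} (Ω' : Set (Euc q)) (Ω : Set (Euc n))
    (a : ℝ → Euc q × Euc n × Euc p → ℂ) : Prop :=
  (∀ ε ∈ Set.Ioc (0:ℝ) 1, ContDiffOn ℝ (⊤ : ℕ∞) (a ε) (Ω' ×ˢ Ω ×ˢ (univ : Set (Euc p)))) ∧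
  (∀ ε ∈ Set.Ioc (0:ℝ) 1, ∀ m : ℝ, ∀ K' ⊆ Ω', IsCompact K' → ∀ K ⊆ Ω, IsCompact K →
    ∀ (α : List (Fin p)) (βx : List (Fin q)) (βy : List (Fin n)),
    ∃ C : ℝ, ∀ x ∈ K', ∀ y ∈ K, ∀ ξ : Euc p,
      jb ξ ^ (-m + (α.length : ℝ)) *
        ‖dirDs (α.map eXi3 ++ βx.map eX3 ++ βy.map eY3) (a ε) (x, y, ξ)‖ ≤ C) ∧
  ∀ K' ⊆ Ω', IsCompact K' → ∀ K ⊆ Ω, IsCompact K → ∃ N : ℕ, ∀ m : ℝ,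
    ∀ (α : List (Fin p)) (βx : List (Fin q)) (βy : List (Fin n)),
    ∃ C > 0, ∃ η ∈ Set.Ioc (0:ℝ) 1, ∀ ε ∈ Set.Ioc (0:ℝ) η,
      ∀ x ∈ K', ∀ y ∈ K, ∀ ξ : Euc p,
      jb ξ ^ (-m + (α.length : ℝ)) *
        ‖dirDs (α.map eXi3 ++ βx.map eX3 ++ βy.map eY3) (a ε) (x, y, ξ)‖ ≤ C * ε ^ (-(N : ℤ))

/-- Nets of phase functions with parameter x ∈ Ω'. -/
def IsPhaseNet3 {q n p : ℕ} (Ω' : Set (Euc q)) (Ω : Set (Euc n))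
    (φ : ℝ → Euc q × Euc n × Euc p → ℝ) : Prop :=
  ∀ ε ∈ Set.Ioc (0:ℝ) 1,
    ContinuousOn (φ ε) (Ω' ×ˢ Ω ×ˢ (univ : Set (Euc p))) ∧
    ContDiffOn ℝ (⊤ : ℕ∞) (φ ε) (Ω' ×ˢ Ω ×ˢ {ξ : Euc p | ξ ≠ 0}) ∧
    (∀ x ∈ Ω', ∀ y ∈ Ω, ∀ ξ : Euc p, ξ ≠ 0 → ∀ t : ℝ, 0 < t →
      φ ε (x, y, t • ξ) = t * φ ε (x, y, ξ)) ∧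
    (∀ x ∈ Ω', ∀ y ∈ Ω, ∀ ξ : Euc p, ξ ≠ 0 → gradSq3 (φ ε) (x, y, ξ) ≠ 0)

/-- S^1_hg-moderateness in all variables for parametrized phase nets. -/
def Hg3Moderate {q n p : ℕ} (Ω' : Set (Euc q)) (Ω : Set (Euc n)) (m : ℝ)
    (φ : ℝ → Euc q × Euc n × Euc p → ℝ) : Prop :=
  ∀ K' ⊆ Ω', IsCompact K' → ∀ K ⊆ Ω, IsCompact K →
    ∀ (α : List (Fin p)) (βx : List (Fin q)) (βy : List (Fin n)),
    ∃ N : ℕ, ∃ C > 0, ∃ η ∈ Set.Ioc (0:ℝ) 1, ∀ ε ∈ Set.Ioc (0:ℝ) η,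
      ∀ x ∈ K', ∀ y ∈ K, ∀ ξ : Euc p, ξ ≠ 0 →
      ‖ξ‖ ^ (-m + (α.length : ℝ)) *
        ‖dirDs (α.map eXi3 ++ βx.map eX3 ++ βy.map eY3) (φ ε) (x, y, ξ)‖ ≤ C * ε ^ (-(N : ℤ))

def Hg3SlowScale {q n p : ℕ} (Ω' : Set (Euc q)) (Ω : Set (Euc n)) (m : ℝ)
    (φ : ℝ → Euc q × Euc n × Euc p → ℝ) : Prop :=
  ∀ K' ⊆ Ω', IsCompact K' → ∀ K ⊆ Ω, IsCompact K →
    ∀ (α : List (Fin p)) (βx : List (Fin q)) (βy : List (Fin n)),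
    ∃ s : ℝ → ℝ, SlowScale s ∧ ∃ η ∈ Set.Ioc (0:ℝ) 1, ∀ ε ∈ Set.Ioc (0:ℝ) η,
      ∀ x ∈ K', ∀ y ∈ K, ∀ ξ : Euc p, ξ ≠ 0 →
      ‖ξ‖ ^ (-m + (α.length : ℝ)) *
        ‖dirDs (α.map eXi3 ++ βx.map eX3 ++ βy.map eY3) (φ ε) (x, y, ξ)‖ ≤ s ε

/-- M_Φ(Ω';Ω×ℝ^p). -/
def MPhi3 {q n p : ℕ} (Ω' : Set (Euc q)) (Ω : Set (Euc n))
    (φ : ℝ → Euc q × Euc n × Euc p → ℝ) : Prop :=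
  IsPhaseNet3 Ω' Ω φ ∧ Hg3Moderate Ω' Ω 1 φ ∧
  ∀ K' ⊆ Ω', IsCompact K' → ∀ K ⊆ Ω, IsCompact K →
    ∃ r > (0:ℝ), ∃ η ∈ Set.Ioc (0:ℝ) 1, ∀ ε ∈ Set.Ioc (0:ℝ) η,
      ∀ x ∈ K', ∀ y ∈ K, ∀ ξ : Euc p, ξ ≠ 0 →
        ε ^ r ≤ gradSq3 (φ ε) (x, y, ‖ξ‖⁻¹ • ξ)

/-- M_{Φ,sc}(Ω';Ω×ℝ^p). -/
def MPhi3Sc {q n p : ℕ} (Ω' : Set (Euc q)) (Ω : Set (Euc n))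
    (φ : ℝ → Euc q × Euc n × Euc p → ℝ) : Prop :=
  IsPhaseNet3 Ω' Ω φ ∧ Hg3SlowScale Ω' Ω 1 φ ∧
  ∀ K' ⊆ Ω', IsCompact K' → ∀ K ⊆ Ω, IsCompact K →
    ∃ s : ℝ → ℝ, SlowScale s ∧ ∃ η ∈ Set.Ioc (0:ℝ) 1, ∀ ε ∈ Set.Ioc (0:ℝ) η,
      ∀ x ∈ K', ∀ y ∈ K, ∀ ξ : Euc p, ξ ≠ 0 →
        (s ε)⁻¹ ≤ gradSq3 (φ ε) (x, y, ‖ξ‖⁻¹ • ξ)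

def varphiN3 {q n p : ℕ} (φ : Euc q × Euc n × Euc p → ℝ) (z : Euc q × Euc n × Euc p) : ℝ :=
  (gradSq3 φ (z.1, z.2.1, ‖z.2.2‖⁻¹ • z.2.2))⁻¹

def coefA3 {q n p : ℕ} (χ : Euc p → ℝ) (φ : Euc q × Euc n × Euc p → ℝ) (j : Fin p) :
    Euc q × Euc n × Euc p → ℂ :=
  fun z => Complex.I * (((1 - χ z.2.2) * varphiN3 φ z * dirD (eXi3 j) φ z : ℝ) : ℂ)

def coefB3 {q n p : ℕ} (χ : Euc p → ℝ) (φ : Euc q × Euc n × Euc p → ℝ) (k : Fin n) :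
    Euc q × Euc n × Euc p → ℂ :=
  fun z => Complex.I * (((1 - χ z.2.2) * (‖z.2.2‖ ^ 2)⁻¹ * varphiN3 φ z * dirD (eY3 k) φ z : ℝ) : ℂ)

def coefC3 {q n p : ℕ} (χ : Euc p → ℝ) (φ : Euc q × Euc n × Euc p → ℝ) :
    Euc q × Euc n × Euc p → ℂ :=
  fun z => ((χ z.2.2 : ℝ) : ℂ) + (∑ j : Fin p, dirD (eXi3 j) (coefA3 χ φ j) z)
    + ∑ k : Fin n, dirD (eY3 k) (coefB3 χ φ k) z

/-- The operator L_φ(x;y,ξ,∂_y,∂_ξ). -/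
def Lop3 {q n p : ℕ} (χ : Euc p → ℝ) (φ : Euc q × Euc n × Euc p → ℝ)
    (f : Euc q × Euc n × Euc p → ℂ) : Euc q × Euc n × Euc p → ℂ :=
  fun z => (∑ j : Fin p, coefA3 χ φ j z * dirD (eXi3 j) f z)
    + (∑ k : Fin n, coefB3 χ φ k z * dirD (eY3 k) f z) + coefC3 χ φ z * f z


/-- Moderate net of order −∞ on Ω×ℝ^p. -/
def SmoothingModerate {n p : ℕ} (Ω : Set (Euc n)) (a : ℝ → Euc n × Euc p → ℂ) : Prop :=
  (∀ ε ∈ Set.Ioc (0:ℝ) 1, ContDiffOn ℝ (⊤ : ℕ∞) (a ε) (Ω ×ˢ (univ : Set (Euc p)))) ∧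
  (∀ ε ∈ Set.Ioc (0:ℝ) 1, ∀ m : ℝ, ∀ K ⊆ Ω, IsCompact K →
    ∀ (α : List (Fin p)) (β : List (Fin n)),
    ∃ C : ℝ, ∀ y ∈ K, ∀ ξ : Euc p,
      jb ξ ^ (-m + (α.length : ℝ)) *
        ‖dirDs (α.map eXi ++ β.map eY) (a ε) (y, ξ)‖ ≤ C) ∧
  ∀ m : ℝ, ∀ K ⊆ Ω, IsCompact K → ∀ (α : List (Fin p)) (β : List (Fin n)),
    ∃ N : ℕ, ∃ C > 0, ∃ η ∈ Set.Ioc (0:ℝ) 1, ∀ ε ∈ Set.Ioc (0:ℝ) η, ∀ y ∈ K, ∀ ξ : Euc p,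
      jb ξ ^ (-m + (α.length : ℝ)) *
        ‖dirDs (α.map eXi ++ β.map eY) (a ε) (y, ξ)‖ ≤ C * ε ^ (-(N : ℤ))

/-- Regular net of order −∞ on Ω×ℝ^p. -/
def SmoothingRegular {n p : ℕ} (Ω : Set (Euc n)) (a : ℝ → Euc n × Euc p → ℂ) : Prop :=
  (∀ ε ∈ Set.Ioc (0:ℝ) 1, ContDiffOn ℝ (⊤ : ℕ∞) (a ε) (Ω ×ˢ (univ : Set (Euc p)))) ∧
  (∀ ε ∈ Set.Ioc (0:ℝ) 1, ∀ m : ℝ, ∀ K ⊆ Ω, IsCompact K →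
    ∀ (α : List (Fin p)) (β : List (Fin n)),
    ∃ C : ℝ, ∀ y ∈ K, ∀ ξ : Euc p,
      jb ξ ^ (-m + (α.length : ℝ)) *
        ‖dirDs (α.map eXi ++ β.map eY) (a ε) (y, ξ)‖ ≤ C) ∧
  ∀ K ⊆ Ω, IsCompact K → ∃ N : ℕ, ∀ m : ℝ, ∀ (α : List (Fin p)) (β : List (Fin n)),
    ∃ C > 0, ∃ η ∈ Set.Ioc (0:ℝ) 1, ∀ ε ∈ Set.Ioc (0:ℝ) η, ∀ y ∈ K, ∀ ξ : Euc p,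
      jb ξ ^ (-m + (α.length : ℝ)) *
        ‖dirDs (α.map eXi ++ β.map eY) (a ε) (y, ξ)‖ ≤ C * ε ^ (-(N : ℤ))

/-- Moderate net in S^m_{ρ,δ}(V) on the conic set V = Ω×(ℝ^p∖0). -/
def ConicModerate {n p : ℕ} (Ω : Set (Euc n)) (m ρ δ : ℝ)
    (a : ℝ → Euc n × Euc p → ℂ) : Prop :=
  (∀ ε ∈ Set.Ioc (0:ℝ) 1, ContDiffOn ℝ (⊤ : ℕ∞) (a ε) (Ω ×ˢ {ξ : Euc p | ξ ≠ 0})) ∧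
  (∀ ε ∈ Set.Ioc (0:ℝ) 1, ∀ K ⊆ Ω ×ˢ {ξ : Euc p | ξ ≠ 0}, IsCompact K →
    ∀ (α : List (Fin p)) (β : List (Fin n)), ∃ C : ℝ, ∀ z ∈ K, ∀ t : ℝ, 1 ≤ t →
      jb (t • z.2) ^ (-m + ρ * (α.length : ℝ) - δ * (β.length : ℝ)) *
        ‖dirDs (α.map eXi ++ β.map eY) (a ε) (z.1, t • z.2)‖ ≤ C) ∧
  ∀ K ⊆ Ω ×ˢ {ξ : Euc p | ξ ≠ 0}, IsCompact K →
    ∀ (α : List (Fin p)) (β : List (Fin n)),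
    ∃ N : ℕ, ∃ C > 0, ∃ η ∈ Set.Ioc (0:ℝ) 1, ∀ ε ∈ Set.Ioc (0:ℝ) η, ∀ z ∈ K, ∀ t : ℝ, 1 ≤ t →
      jb (t • z.2) ^ (-m + ρ * (α.length : ℝ) - δ * (β.length : ℝ)) *
        ‖dirDs (α.map eXi ++ β.map eY) (a ε) (z.1, t • z.2)‖ ≤ C * ε ^ (-(N : ℤ))

/-- Negligible net in S^m_{ρ,δ}(V) on the conic set V = Ω×(ℝ^p∖0). -/
def ConicNegligible {n p : ℕ} (Ω : Set (Euc n)) (m ρ δ : ℝ)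
    (a : ℝ → Euc n × Euc p → ℂ) : Prop :=
  (∀ ε ∈ Set.Ioc (0:ℝ) 1, ContDiffOn ℝ (⊤ : ℕ∞) (a ε) (Ω ×ˢ {ξ : Euc p | ξ ≠ 0})) ∧
  (∀ ε ∈ Set.Ioc (0:ℝ) 1, ∀ K ⊆ Ω ×ˢ {ξ : Euc p | ξ ≠ 0}, IsCompact K →
    ∀ (α : List (Fin p)) (β : List (Fin n)), ∃ C : ℝ, ∀ z ∈ K, ∀ t : ℝ, 1 ≤ t →
      jb (t • z.2) ^ (-m + ρ * (α.length : ℝ) - δ * (β.length : ℝ)) *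
        ‖dirDs (α.map eXi ++ β.map eY) (a ε) (z.1, t • z.2)‖ ≤ C) ∧
  ∀ K ⊆ Ω ×ˢ {ξ : Euc p | ξ ≠ 0}, IsCompact K →
    ∀ (α : List (Fin p)) (β : List (Fin n)), ∀ q : ℕ,
    ∃ C > 0, ∃ η ∈ Set.Ioc (0:ℝ) 1, ∀ ε ∈ Set.Ioc (0:ℝ) η, ∀ z ∈ K, ∀ t : ℝ, 1 ≤ t →
      jb (t • z.2) ^ (-m + ρ * (α.length : ℝ) - δ * (β.length : ℝ)) *
        ‖dirDs (α.map eXi ++ β.map eY) (a ε) (z.1, t • z.2)‖ ≤ C * ε ^ q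

/-- A point (x₀,ξ₀) at which |∇_ξφ|² is invertible on a neighborhood U×Γ. -/
def InvPt {n p : ℕ} (Ω : Set (Euc n)) (φ : ℝ → Euc n × Euc p → ℝ)
    (z : Euc n × Euc p) : Prop :=
  ∃ U : Set (Euc n), IsOpen U ∧ z.1 ∈ U ∧ U ⊆ Ω ∧ IsCompact (closure U) ∧
  ∃ Γ : Set (Euc p), IsOpen Γ ∧ z.2 ∈ Γ ∧ (∀ ξ ∈ Γ, ∀ t : ℝ, 0 < t → t • ξ ∈ Γ) ∧
  ∃ r : ℝ, ∃ η ∈ Set.Ioc (0:ℝ) 1, ∀ ε ∈ Set.Ioc (0:ℝ) η, ∀ y ∈ U, ∀ ξ ∈ Γ,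
    ε ^ r ≤ gradXiSq (φ ε) (y, ξ)

/-- A point (x₀,ξ₀) at which |∇_ξφ|² is slow scale-invertible on a neighborhood U×Γ. -/
def InvPtSc {n p : ℕ} (Ω : Set (Euc n)) (φ : ℝ → Euc n × Euc p → ℝ)
    (z : Euc n × Euc p) : Prop :=
  ∃ U : Set (Euc n), IsOpen U ∧ z.1 ∈ U ∧ U ⊆ Ω ∧ IsCompact (closure U) ∧
  ∃ Γ : Set (Euc p), IsOpen Γ ∧ z.2 ∈ Γ ∧ (∀ ξ ∈ Γ, ∀ t : ℝ, 0 < t → t • ξ ∈ Γ) ∧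
  ∃ s : ℝ → ℝ, SlowScale s ∧ ∃ η ∈ Set.Ioc (0:ℝ) 1, ∀ ε ∈ Set.Ioc (0:ℝ) η, ∀ y ∈ U, ∀ ξ ∈ Γ,
    (s ε)⁻¹ ≤ gradXiSq (φ ε) (y, ξ)

/-- The set C_φ. -/
def Cphi {n p : ℕ} (Ω : Set (Euc n)) (φ : ℝ → Euc n × Euc p → ℝ) : Set (Euc n × Euc p) :=
  {z | z.1 ∈ Ω ∧ z.2 ≠ 0 ∧ ¬ InvPt Ω φ z}

/-- The set R_φ = Ω ∖ π_Ω(C_φ). -/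
def Rphi {n p : ℕ} (Ω : Set (Euc n)) (φ : ℝ → Euc n × Euc p → ℝ) : Set (Euc n) :=
  Ω \ (Prod.fst '' Cphi Ω φ)

/-- The set C^sc_φ. -/
def CphiSc {n p : ℕ} (Ω : Set (Euc n)) (φ : ℝ → Euc n × Euc p → ℝ) : Set (Euc n × Euc p) :=
  {z | z.1 ∈ Ω ∧ z.2 ≠ 0 ∧ ¬ InvPtSc Ω φ z}

/-- The set R^sc_φ = Ω ∖ π_Ω(C^sc_φ). -/
def RphiSc {n p : ℕ} (Ω : Set (Euc n)) (φ : ℝ → Euc n × Euc p → ℝ) : Set (Euc n) :=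
  Ω \ (Prod.fst '' CphiSc Ω φ)

/-- 1/|∇_ξφ(y,ξ/|ξ|)|². -/
def varphiXi {n p : ℕ} (φ : Euc n × Euc p → ℝ) (z : Euc n × Euc p) : ℝ :=
  (gradXiSq φ (z.1, ‖z.2‖⁻¹ • z.2))⁻¹

/-- The transposed regularizing operator in the ξ-variables only:
    ᵗL f = −Σ_j a_j ∂_{ξ_j} f + χ f  with a_j = i(1−χ)|∇_ξφ|⁻²∂_{ξ_j}φ. -/
def tLxi {n p : ℕ} (χ : Euc p → ℝ) (φ : Euc n × Euc p → ℝ) (f : Euc n × Euc p → ℂ) :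
    Euc n × Euc p → ℂ :=
  fun z => -(∑ j : Fin p,
      (Complex.I * (((1 - χ z.2) * varphiXi φ z * dirD (eXi j) φ z : ℝ) : ℂ)) *
        dirD (eXi j) f z)
    + ((χ z.2 : ℝ) : ℂ) * f z

/-- d_{j}(y,θ,ξ) = (ξ_j − ∂_{y_j}φ(y,θ))/|ξ−∇_yφ(y,θ)|². -/
def dj {n p : ℕ} (φ : Euc n × Euc p → ℝ) (ξ : Euc n) (j : Fin n)
    (z : Euc n × Euc p) : ℝ :=
  (ξ j - dirD (eY j) φ z) / ‖ξ - gradY φ z‖ ^ 2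

/-- ᵗL_ε f = −Σ_j d_j D_{y_j} f − Σ_j (D_{y_j} d_j) f, with D_{y_j} = −i∂_{y_j}. -/
def tLW {n p : ℕ} (φ : Euc n × Euc p → ℝ) (ξ : Euc n) (f : Euc n × Euc p → ℂ) :
    Euc n × Euc p → ℂ :=
  fun z => -(∑ j : Fin n, ((dj φ ξ j z : ℝ) : ℂ) * (-Complex.I * dirD (eY j) f z))
    - ∑ j : Fin n, (-Complex.I * ((dirD (eY j) (dj φ ξ j) z : ℝ) : ℂ)) * f z

section SymbolNets

variable {n p : ℕ}

/-- The domain `Ω × (ℝ^p ∖ 0)`. -/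
def puncturedDomain (p : ℕ) (Ω : Set (Euc n)) : Set (Euc n × Euc p) :=
  Ω ×ˢ {ξ : Euc p | ξ ≠ 0}

theorem isOpen_puncturedDomain {Ω : Set (Euc n)} (hΩ : IsOpen Ω) :
    IsOpen (puncturedDomain p Ω) :=
  hΩ.prod isOpen_ne

/-- Coordinate directions: `ξ`-directions on the left, `y`-directions on the right. -/
def coordDir : Fin p ⊕ Fin n → Euc n × Euc p
  | .inl j => eXi j
  | .inr k => eY k

/-- The drop in homogeneity caused by differentiating along a coordinate direction. -/
def coordDeg : Fin p ⊕ Fin n → ℝ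
  | .inl _ => 1
  | .inr _ => 0

/-- The total drop in homogeneity along a list of directions. -/
def listDeg (L : List (Fin p ⊕ Fin n)) : ℝ := (L.map coordDeg).sum

theorem exists_perm_inl_append_inr (L : List (Fin p ⊕ Fin n)) :
    ∃ (α : List (Fin p)) (β : List (Fin n)), L.Perm (α.map Sum.inl ++ β.map Sum.inr) := by
  induction L with
  | nil => exact ⟨[], [], .refl _⟩
  | cons i L ih =>
    obtain ⟨α, β, h⟩ := ih
    cases i with
    | inl j => exact ⟨j :: α, β, h.cons _⟩
    | inr k => exact ⟨α, k :: β, (h.cons _).trans List.perm_middle.symm⟩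

theorem listDeg_inl_append_inr (α : List (Fin p)) (β : List (Fin n)) :
    listDeg (α.map Sum.inl ++ β.map Sum.inr) = α.length := by
  have h1 : (coordDeg (n := n) (p := p)) ∘ Sum.inl = fun _ => 1 := rfl
  have h2 : (coordDeg (n := n) (p := p)) ∘ Sum.inr = fun _ => 0 := rfl
  simp [listDeg, h1, h2]

theorem map_coordDir_inl_append_inr (α : List (Fin p)) (β : List (Fin n)) :
    (α.map Sum.inl ++ β.map Sum.inr).map coordDir = α.map eXi ++ β.map eY := by
  simp only [List.map_append, List.map_map]
  rfl

section Calculus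

variable {E : Type*} [NormedAddCommGroup E] [NormedSpace ℝ E] {U : Set E}

theorem eqOn_dirD (hU : IsOpen U) {f g : E → ℝ} (h : EqOn f g U) (v : E) :
    EqOn (dirD v f) (dirD v g) U := fun z hz => by
  simp only [dirD]
  rw [(h.eventuallyEq_of_mem (hU.mem_nhds hz)).fderiv_eq]

theorem dirD_const (v : E) (c : ℝ) : dirD v (fun _ => c) = fun _ => 0 := by
  ext z
  simp [dirD]

theorem contDiffOn_dirD (hU : IsOpen U) {f : E → ℝ}
    (hf : ContDiffOn ℝ (⊤ : ℕ∞) f U) (v : E) : ContDiffOn ℝ (⊤ : ℕ∞) (dirD v f) U :=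
  (hf.fderiv_of_isOpen hU (m := ((⊤ : ℕ∞) : WithTop ℕ∞)) (by exact_mod_cast le_top)).clm_apply
    contDiffOn_const

theorem contDiffOn_dirDs (hU : IsOpen U) {f : E → ℝ}
    (hf : ContDiffOn ℝ (⊤ : ℕ∞) f U) (L : List E) : ContDiffOn ℝ (⊤ : ℕ∞) (dirDs L f) U := by
  induction L with
  | nil => exact hf
  | cons v L ih => exact contDiffOn_dirD hU ih v

theorem differentiableAt_of_contDiffOn (hU : IsOpen U) {f : E → ℝ}
    (hf : ContDiffOn ℝ (⊤ : ℕ∞) f U) {z : E} (hz : z ∈ U) : DifferentiableAt ℝ f z :=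
  (hf.contDiffAt (hU.mem_nhds hz)).differentiableAt (by simp)

theorem dirD_comm (hU : IsOpen U) {f : E → ℝ}
    (hf : ContDiffOn ℝ (⊤ : ℕ∞) f U) (v w : E) :
    EqOn (dirD v (dirD w f)) (dirD w (dirD v f)) U := fun z hz => by
  have hsymm : IsSymmSndFDerivAt ℝ f z :=
    (hf.contDiffAt (hU.mem_nhds hz)).isSymmSndFDerivAt
      (by
        rw [minSmoothness_of_isRCLikeNormedField]
        exact WithTop.coe_le_coe.2 (le_top : (2 : ℕ∞) ≤ ⊤))
  have hd : DifferentiableAt ℝ (fderiv ℝ f) z :=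
    ((hf.fderiv_of_isOpen hU (m := ((⊤ : ℕ∞) : WithTop ℕ∞))
      (by exact_mod_cast le_top)).contDiffAt (hU.mem_nhds hz)).differentiableAt (by simp)
  have key (a b : E) : dirD a (dirD b f) z = fderiv ℝ (fderiv ℝ f) z a b := by
    have : HasFDerivAt (dirD b f) _ z := hd.hasFDerivAt.clm_apply (hasFDerivAt_const b z)
    rw [dirD, this.fderiv]
    simp
  rw [key, key, hsymm.eq]

theorem dirDs_perm (hU : IsOpen U) {f : E → ℝ} (hf : ContDiffOn ℝ (⊤ : ℕ∞) f U)
    {L L' : List E} (h : L.Perm L') : EqOn (dirDs L f) (dirDs L' f) U := by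
  induction h with
  | nil => exact fun _ _ => rfl
  | cons v _ ih => exact eqOn_dirD hU ih v
  | swap v w L => exact dirD_comm hU (contDiffOn_dirDs hU hf L) w v
  | trans _ _ ih ih' => exact ih.trans ih'

end Calculus

/-- Nets of smooth functions on the punctured domain. -/
def SmoothNet (Ω : Set (Euc n)) (f : ℝ → Euc n × Euc p → ℝ) : Prop :=
  ∀ ε ∈ Ioc (0 : ℝ) 1, ContDiffOn ℝ (⊤ : ℕ∞) (f ε) (puncturedDomain p Ω)

/-- Two nets agree on the punctured domain. -/
def NetEq (Ω : Set (Euc n)) (f g : ℝ → Euc n × Euc p → ℝ) : Prop :=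
  ∀ ε ∈ Ioc (0 : ℝ) 1, EqOn (f ε) (g ε) (puncturedDomain p Ω)

/-- A net of functions is `O(ε^s |ξ|^m)` uniformly for `y ∈ K`, `ξ ≠ 0`. -/
def RateBd (K : Set (Euc n)) (s m : ℝ) (f : ℝ → Euc n × Euc p → ℝ) : Prop :=
  ∃ C : ℝ, 0 ≤ C ∧ ∀ᶠ ε in 𝓝[>] (0 : ℝ), ∀ y ∈ K, ∀ ξ : Euc p, ξ ≠ 0 →
    |f ε (y, ξ)| ≤ C * ε ^ s * ‖ξ‖ ^ m

/-- Moderate growth of order `m` over `K`, without derivatives. -/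
def ModBd (K : Set (Euc n)) (m : ℝ) (f : ℝ → Euc n × Euc p → ℝ) : Prop :=
  ∃ s, RateBd K s m f

/-- Negligible growth of order `m` over `K`, without derivatives. -/
def NegBd (K : Set (Euc n)) (m : ℝ) (f : ℝ → Euc n × Euc p → ℝ) : Prop :=
  ∀ s, RateBd K s m f

theorem eventually_mem_Ioc : ∀ᶠ ε in 𝓝[>] (0 : ℝ), ε ∈ Ioc (0 : ℝ) 1 :=
  Ioc_mem_nhdsGT one_pos

namespace RateBd

variable {K : Set (Euc n)} {s s' m m' : ℝ} {f g : ℝ → Euc n × Euc p → ℝ}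

theorem mono (h : RateBd K s m f) (hs : s' ≤ s) : RateBd K s' m f := by
  obtain ⟨C, hC, h⟩ := h
  refine ⟨C, hC, ?_⟩
  filter_upwards [h, eventually_mem_Ioc] with ε h hε y hy ξ hξ
  have := Real.rpow_le_rpow_of_exponent_ge hε.1 hε.2 hs
  exact (h y hy ξ hξ).trans (by gcongr)

theorem add (hf : RateBd K s m f) (hg : RateBd K s m g) :
    RateBd K s m (fun ε z => f ε z + g ε z) := by
  obtain ⟨C, hC, hf⟩ := hf
  obtain ⟨D, hD, hg⟩ := hg
  refine ⟨C + D, by positivity, ?_⟩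
  filter_upwards [hf, hg] with ε hf hg y hy ξ hξ
  calc |f ε (y, ξ) + g ε (y, ξ)| ≤ |f ε (y, ξ)| + |g ε (y, ξ)| := abs_add_le _ _
    _ ≤ C * ε ^ s * ‖ξ‖ ^ m + D * ε ^ s * ‖ξ‖ ^ m := add_le_add (hf y hy ξ hξ) (hg y hy ξ hξ)
    _ = _ := by ring

theorem mul (hf : RateBd K s m f) (hg : RateBd K s' m' g) :
    RateBd K (s + s') (m + m') (fun ε z => f ε z * g ε z) := by
  obtain ⟨C, hC, hf⟩ := hf
  obtain ⟨D, hD, hg⟩ := hg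
  refine ⟨C * D, by positivity, ?_⟩
  filter_upwards [hf, hg, eventually_mem_Ioc] with ε hf hg hε y hy ξ hξ
  have hε0 := hε.1
  have hξ0 : 0 < ‖ξ‖ := norm_pos_iff.mpr hξ
  calc |f ε (y, ξ) * g ε (y, ξ)| = |f ε (y, ξ)| * |g ε (y, ξ)| := abs_mul _ _
    _ ≤ (C * ε ^ s * ‖ξ‖ ^ m) * (D * ε ^ s' * ‖ξ‖ ^ m') :=
      mul_le_mul (hf y hy ξ hξ) (hg y hy ξ hξ) (abs_nonneg _) (by positivity)
    _ = _ := by rw [Real.rpow_add hε0, Real.rpow_add hξ0]; ring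

theorem congr {Ω : Set (Euc n)} (hK : K ⊆ Ω) (hfg : NetEq Ω f g) (hf : RateBd K s m f) :
    RateBd K s m g := by
  obtain ⟨C, hC, hf⟩ := hf
  refine ⟨C, hC, ?_⟩
  filter_upwards [hf, eventually_mem_Ioc] with ε hf hε y hy ξ hξ
  rw [← hfg ε hε (mk_mem_prod (hK hy) hξ)]
  exact hf y hy ξ hξ

theorem zero : RateBd K s m (fun _ (_ : Euc n × Euc p) => 0) :=
  ⟨0, le_rfl, .of_forall fun _ _ _ _ _ => by simp⟩

end RateBd

/-- The closure properties of growth conditions that are inherited by all derivatives. -/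
structure IsGrowth (Ω : Set (Euc n)) (B : ℝ → (ℝ → Euc n × Euc p → ℝ) → Prop) : Prop where
  add : ∀ {m f g}, B m f → B m g → B m (fun ε z => f ε z + g ε z)
  congr : ∀ {m f g}, NetEq Ω f g → B m f → B m g
  zero : ∀ m, B m (fun _ _ => 0)

theorem isGrowth_modBd {K Ω : Set (Euc n)} (hK : K ⊆ Ω) : IsGrowth (p := p) Ω (ModBd K) where
  add := fun ⟨s, hf⟩ ⟨t, hg⟩ =>
    ⟨min s t, (hf.mono (min_le_left _ _)).add (hg.mono (min_le_right _ _))⟩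
  congr := fun h ⟨s, hf⟩ => ⟨s, hf.congr hK h⟩
  zero := fun _ => ⟨0, .zero⟩

theorem isGrowth_negBd {K Ω : Set (Euc n)} (hK : K ⊆ Ω) : IsGrowth (p := p) Ω (NegBd K) where
  add := fun hf hg s => (hf s).add (hg s)
  congr := fun h hf s => (hf s).congr hK h
  zero := fun _ _ => .zero

theorem ModBd.mul {K : Set (Euc n)} {m m' : ℝ} {f g : ℝ → Euc n × Euc p → ℝ}
    (hf : ModBd K m f) (hg : ModBd K m' g) : ModBd K (m + m') (fun ε z => f ε z * g ε z) :=
  let ⟨_, hf⟩ := hf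
  let ⟨_, hg⟩ := hg
  ⟨_, hf.mul hg⟩

theorem NegBd.mul {K : Set (Euc n)} {m m' : ℝ} {f g : ℝ → Euc n × Euc p → ℝ}
    (hf : NegBd K m f) (hg : ModBd K m' g) : NegBd K (m + m') (fun ε z => f ε z * g ε z) :=
  fun s => by
    obtain ⟨t, hg⟩ := hg
    simpa using (hf (s - t)).mul hg

/-- The growth condition `B` holds for all derivatives of order at most `k`. -/
def DerBd (B : ℝ → (ℝ → Euc n × Euc p → ℝ) → Prop) :
    ℕ → ℝ → (ℝ → Euc n × Euc p → ℝ) → Prop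
  | 0, m, f => B m f
  | k + 1, m, f => B m f ∧ ∀ i, DerBd B k (m - coordDeg i) (fun ε => dirD (coordDir i) (f ε))

namespace DerBd

variable {Ω : Set (Euc n)} {B B₁ B₂ : ℝ → (ℝ → Euc n × Euc p → ℝ) → Prop}
  {f g : ℝ → Euc n × Euc p → ℝ} {m m' : ℝ} {k : ℕ}

theorem base (h : DerBd B k m f) : B m f := by
  cases k with
  | zero => exact h
  | succ k => exact h.1

theorem of_succ (h : DerBd B (k + 1) m f) : DerBd B k m f := by
  induction k generalizing m f with
  | zero => exact h.1
  | succ k ih => exact ⟨h.1, fun i => ih (h.2 i)⟩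

theorem congr (hΩ : IsOpen Ω) (hB : IsGrowth Ω B) (hfg : NetEq Ω f g) (h : DerBd B k m f) :
    DerBd B k m g := by
  induction k generalizing m f g with
  | zero => exact hB.congr hfg h
  | succ k ih =>
    exact ⟨hB.congr hfg h.1, fun i =>
      ih (fun ε hε => eqOn_dirD (isOpen_puncturedDomain hΩ) (hfg ε hε) _) (h.2 i)⟩

theorem add (hΩ : IsOpen Ω) (hB : IsGrowth Ω B) (sf : SmoothNet Ω f) (sg : SmoothNet Ω g)
    (hf : DerBd B k m f) (hg : DerBd B k m g) : DerBd B k m (fun ε z => f ε z + g ε z) := by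
  have hU := isOpen_puncturedDomain (p := p) hΩ
  induction k generalizing m f g with
  | zero => exact hB.add hf hg
  | succ k ih =>
    refine ⟨hB.add hf.1 hg.1, fun i => (ih (fun ε hε => contDiffOn_dirD hU (sf ε hε) _)
      (fun ε hε => contDiffOn_dirD hU (sg ε hε) _) (hf.2 i) (hg.2 i)).congr hΩ hB ?_⟩
    intro ε hε z hz
    simp only [dirD]
    rw [fderiv_fun_add (differentiableAt_of_contDiffOn hU (sf ε hε) hz)
      (differentiableAt_of_contDiffOn hU (sg ε hε) hz)]
    rfl

theorem mul (hΩ : IsOpen Ω) (hB : IsGrowth Ω B)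
    (hmul : ∀ {m m' f g}, B₁ m f → B₂ m' g → B (m + m') (fun ε z => f ε z * g ε z))
    (sf : SmoothNet Ω f) (sg : SmoothNet Ω g)
    (hf : DerBd B₁ k m f) (hg : DerBd B₂ k m' g) :
    DerBd B k (m + m') (fun ε z => f ε z * g ε z) := by
  have hU := isOpen_puncturedDomain (p := p) hΩ
  induction k generalizing m m' f g with
  | zero => exact hmul hf hg
  | succ k ih =>
    refine ⟨hmul hf.1 hg.1, fun i => ?_⟩
    have sf' : SmoothNet Ω (fun ε => dirD (coordDir i) (f ε)) :=
      fun ε hε => contDiffOn_dirD hU (sf ε hε) _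
    have sg' : SmoothNet Ω (fun ε => dirD (coordDir i) (g ε)) :=
      fun ε hε => contDiffOn_dirD hU (sg ε hε) _
    have h1 := ih sf' sg (hf.2 i) hg.of_succ
    have h2 := ih sf sg' hf.of_succ (hg.2 i)
    rw [show m - coordDeg i + m' = m + m' - coordDeg i by ring] at h1
    rw [← add_sub_assoc] at h2
    refine (h1.add hΩ hB (fun ε hε => (sf' ε hε).mul (sg ε hε))
      (fun ε hε => (sf ε hε).mul (sg' ε hε)) h2).congr hΩ hB ?_
    intro ε hε z hz
    simp only [dirD]
    rw [fderiv_fun_mul (differentiableAt_of_contDiffOn hU (sf ε hε) hz)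
      (differentiableAt_of_contDiffOn hU (sg ε hε) hz)]
    simp
    ring

theorem zero (hB : IsGrowth Ω B) : DerBd B k m (fun _ _ => 0) := by
  induction k generalizing m with
  | zero => exact hB.zero m
  | succ k ih => exact ⟨hB.zero m, fun i => by simpa only [dirD_const] using ih⟩

theorem of_dirDs (h : ∀ L : List (Fin p ⊕ Fin n),
    B (m - listDeg L) (fun ε => dirDs (L.map coordDir) (f ε))) (k : ℕ) : DerBd B k m f := by
  have h0 : B m f := by simpa [listDeg, dirDs] using h []
  induction k generalizing m f with
  | zero => exact h0
  | succ k ih =>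
    have h' (i) (L : List (Fin p ⊕ Fin n)) : B (m - coordDeg i - listDeg L)
        (fun ε => dirDs (L.map coordDir) (dirD (coordDir i) (f ε))) := by
      have := h (L ++ [i])
      simp only [listDeg, dirDs, List.map_append, List.sum_append, List.foldr_append] at this ⊢
      convert this using 1
      · simp
        ring
      · rfl
    exact ⟨h0, fun i => ih (h' i) (by simpa [listDeg, dirDs] using h' i [])⟩

theorem dirDs (h : ∀ k, DerBd B k m f) (L : List (Fin p ⊕ Fin n)) :
    B (m - listDeg L) (fun ε => dirDs (L.map coordDir) (f ε)) := by
  induction L using List.reverseRecOn generalizing m f with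
  | nil =>
    rw [listDeg, List.map_nil, List.sum_nil, sub_zero]
    exact h 0
  | append_singleton L i ih =>
    have := ih (fun k => (h (k + 1)).2 i)
    simp only [listDeg, _root_.dirDs, List.map_append, List.sum_append,
      List.foldr_append] at this ⊢
    convert this using 1
    · simp
      ring
    · rfl

end DerBd

/-- Nets of symbols of order `m` whose derivatives all satisfy the growth condition `B`. -/
structure IsSymb (Ω : Set (Euc n)) (B : ℝ → (ℝ → Euc n × Euc p → ℝ) → Prop) (m : ℝ)
    (f : ℝ → Euc n × Euc p → ℝ) : Prop where
  smooth : SmoothNet Ω f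
  bound : ∀ k, DerBd B k m f

namespace IsSymb

variable {Ω K : Set (Euc n)} {B : ℝ → (ℝ → Euc n × Euc p → ℝ) → Prop}
  {f g : ℝ → Euc n × Euc p → ℝ} {m m' : ℝ}

theorem congr (hΩ : IsOpen Ω) (hB : IsGrowth Ω B) (hf : IsSymb Ω B m f) (h : NetEq Ω f g) :
    IsSymb Ω B m g where
  smooth := fun ε hε => (hf.smooth ε hε).congr fun _ hz => (h ε hε hz).symm
  bound := fun k => (hf.bound k).congr hΩ hB h

theorem add (hΩ : IsOpen Ω) (hB : IsGrowth Ω B) (hf : IsSymb Ω B m f) (hg : IsSymb Ω B m g) :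
    IsSymb Ω B m (fun ε z => f ε z + g ε z) where
  smooth := fun ε hε => (hf.smooth ε hε).add (hg.smooth ε hε)
  bound := fun k => (hf.bound k).add hΩ hB hf.smooth hg.smooth (hg.bound k)

theorem zero (hB : IsGrowth Ω B) : IsSymb Ω B m (fun _ _ => 0) where
  smooth := fun _ _ => contDiffOn_const
  bound := fun _ => .zero hB

theorem sum (hΩ : IsOpen Ω) (hB : IsGrowth Ω B) {ι : Type*} (t : Finset ι)
    {F : ι → ℝ → Euc n × Euc p → ℝ} (hF : ∀ i ∈ t, IsSymb Ω B m (F i)) :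
    IsSymb Ω B m (fun ε z => ∑ i ∈ t, F i ε z) := by
  classical
  induction t using Finset.induction_on with
  | empty => simpa using zero hB
  | insert a t ha ih =>
    simp only [Finset.sum_insert ha]
    exact (hF a (Finset.mem_insert_self a t)).add hΩ hB
      (ih fun i hi => hF i (Finset.mem_insert_of_mem hi))

theorem mul_mod (hΩ : IsOpen Ω) (hK : K ⊆ Ω) (hf : IsSymb Ω (ModBd K) m f)
    (hg : IsSymb Ω (ModBd K) m' g) : IsSymb Ω (ModBd K) (m + m') (fun ε z => f ε z * g ε z) where
  smooth := fun ε hε => (hf.smooth ε hε).mul (hg.smooth ε hε)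
  bound := fun k =>
    .mul hΩ (isGrowth_modBd hK) ModBd.mul hf.smooth hg.smooth (hf.bound k) (hg.bound k)

theorem neg_mul_mod (hΩ : IsOpen Ω) (hK : K ⊆ Ω) (hf : IsSymb Ω (NegBd K) m f)
    (hg : IsSymb Ω (ModBd K) m' g) : IsSymb Ω (NegBd K) (m + m') (fun ε z => f ε z * g ε z) where
  smooth := fun ε hε => (hf.smooth ε hε).mul (hg.smooth ε hε)
  bound := fun k =>
    .mul hΩ (isGrowth_negBd hK) NegBd.mul hf.smooth hg.smooth (hf.bound k) (hg.bound k)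

theorem dirD (hΩ : IsOpen Ω) (hf : IsSymb Ω B m f) (i : Fin p ⊕ Fin n) :
    IsSymb Ω B (m - coordDeg i) (fun ε => dirD (coordDir i) (f ε)) where
  smooth := fun ε hε => contDiffOn_dirD (isOpen_puncturedDomain hΩ) (hf.smooth ε hε) _
  bound := fun k => (hf.bound (k + 1)).2 i

theorem const (hK : K ⊆ Ω) (c : ℝ) : IsSymb (p := p) Ω (ModBd K) 0 (fun _ _ => c) where
  smooth := fun _ _ => contDiffOn_const
  bound := fun k => by
    have h0 : ModBd (p := p) K 0 (fun _ _ => c) :=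
      ⟨0, |c|, abs_nonneg c, .of_forall fun _ _ _ _ _ => by simp⟩
    cases k with
    | zero => exact h0
    | succ k =>
      exact ⟨h0, fun i => by
        simpa only [dirD_const] using DerBd.zero (m := 0 - coordDeg i) (isGrowth_modBd hK)⟩

theorem inv (hΩ : IsOpen Ω) (hK : K ⊆ Ω) (hf : IsSymb Ω (ModBd K) m f)
    (hne : ∀ ε ∈ Ioc (0 : ℝ) 1, ∀ z ∈ puncturedDomain p Ω, f ε z ≠ 0)
    (hinv : ModBd K (-m) (fun ε z => (f ε z)⁻¹)) :
    IsSymb Ω (ModBd K) (-m) (fun ε z => (f ε z)⁻¹) := by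
  have hU := isOpen_puncturedDomain (p := p) hΩ
  have hB := isGrowth_modBd (p := p) hK
  have sinv : SmoothNet Ω (fun ε z => (f ε z)⁻¹) :=
    fun ε hε => (hf.smooth ε hε).inv (hne ε hε)
  refine ⟨sinv, fun k => ?_⟩
  induction k with
  | zero => exact hinv
  | succ k ih =>
    refine ⟨hinv, fun i => ?_⟩
    have hd := ((const hK (-1)).mul_mod hΩ hK (hf.dirD hΩ i))
    have hsq := DerBd.mul hΩ hB ModBd.mul sinv sinv ih ih
    have h := DerBd.mul hΩ hB ModBd.mul hd.smooth
      (fun ε hε => (sinv ε hε).mul (sinv ε hε)) (hd.bound k) hsq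
    rw [show 0 + (m - coordDeg i) + (-m + -m) = -m - coordDeg i by ring] at h
    refine h.congr hΩ hB fun ε hε z hz => ?_
    have hdiff := (differentiableAt_of_contDiffOn hU (hf.smooth ε hε) hz).hasFDerivAt
    have h' : HasFDerivAt (fun z => (f ε z)⁻¹) _ z :=
      (hasDerivAt_inv (hne ε hε z hz)).comp_hasFDerivAt z hdiff
    simp only [_root_.dirD]
    rw [h'.fderiv]
    simp only [_root_.smul_apply, smul_eq_mul]
    field_simp

theorem of_dirDs (hΩ : IsOpen Ω) (hB : IsGrowth Ω B) (sf : SmoothNet Ω f)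
    (h : ∀ (α : List (Fin p)) (β : List (Fin n)),
      B (m - α.length) (fun ε => dirDs (α.map eXi ++ β.map eY) (f ε))) : IsSymb Ω B m f := by
  refine ⟨sf, DerBd.of_dirDs fun L => ?_⟩
  obtain ⟨α, β, hL⟩ := exists_perm_inl_append_inr L
  have hdeg : listDeg L = α.length := by
    rw [← listDeg_inl_append_inr α β]
    exact (hL.map _).sum_eq
  rw [hdeg]
  refine hB.congr (fun ε hε => ?_) (h α β)
  rw [← map_coordDir_inl_append_inr]
  exact dirDs_perm (isOpen_puncturedDomain hΩ) (sf ε hε) (hL.symm.map _)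

end IsSymb

theorem isSymb_of_hgModerate {Ω K : Set (Euc n)} (hΩ : IsOpen Ω) (hK : K ⊆ Ω)
    (hKc : IsCompact K) {m : ℝ} {f : ℝ → Euc n × Euc p → ℝ} (sf : SmoothNet Ω f)
    (hf : HgModerate Ω m f) : IsSymb Ω (ModBd K) m f := by
  refine .of_dirDs hΩ (isGrowth_modBd hK) sf fun α β => ?_
  obtain ⟨N, C, hC, η, hη, h⟩ := hf K hK hKc α β
  refine ⟨-(N : ℝ), C, hC.le, ?_⟩
  filter_upwards [Ioc_mem_nhdsGT hη.1] with ε hε y hy ξ hξ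
  have hξ0 : 0 < ‖ξ‖ := norm_pos_iff.mpr hξ
  have h := h ε hε y hy ξ hξ
  rw [show m - α.length = -(-m + α.length) by ring, Real.rpow_neg hξ0.le,
    ← div_eq_mul_inv, le_div_iff₀ (by positivity), mul_comm]
  rwa [Real.norm_eq_abs, ← Real.rpow_intCast, Int.cast_neg, Int.cast_natCast] at h

theorem isSymb_of_hgNegligible {Ω K : Set (Euc n)} (hΩ : IsOpen Ω) (hK : K ⊆ Ω)
    (hKc : IsCompact K) {m : ℝ} {f : ℝ → Euc n × Euc p → ℝ} (sf : SmoothNet Ω f)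
    (hf : HgNegligible Ω m f) : IsSymb Ω (NegBd K) m f := by
  refine .of_dirDs hΩ (isGrowth_negBd hK) sf fun α β s => ?_
  obtain ⟨q, hq⟩ := exists_nat_ge s
  obtain ⟨C, hC, η, hη, h⟩ := hf K hK hKc α β q
  refine RateBd.mono ⟨C, hC.le, ?_⟩ hq
  filter_upwards [Ioc_mem_nhdsGT hη.1] with ε hε y hy ξ hξ
  have hξ0 : 0 < ‖ξ‖ := norm_pos_iff.mpr hξ
  have h := h ε hε y hy ξ hξ
  rw [show m - α.length = -(-m + α.length) by ring, Real.rpow_neg hξ0.le,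
    ← div_eq_mul_inv, le_div_iff₀ (by positivity), mul_comm]
  rwa [Real.norm_eq_abs, ← Real.rpow_natCast] at h

theorem hgNegligible_of_isSymb {Ω : Set (Euc n)} {m : ℝ} {f : ℝ → Euc n × Euc p → ℝ}
    (hf : ∀ K ⊆ Ω, IsCompact K → IsSymb Ω (NegBd K) m f) : HgNegligible Ω m f := by
  intro K hK hKc α β q
  obtain ⟨C, hC, h⟩ := DerBd.dirDs (hf K hK hKc).bound (α.map Sum.inl ++ β.map Sum.inr) q
  rw [listDeg_inl_append_inr, map_coordDir_inl_append_inr] at h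
  obtain ⟨η, hη, h⟩ := mem_nhdsGT_iff_exists_Ioc_subset.1 h
  refine ⟨C + 1, by positivity, min η 1, ⟨lt_min hη one_pos, min_le_right _ _⟩, ?_⟩
  intro ε hε y hy ξ hξ
  have hξ0 : 0 < ‖ξ‖ := norm_pos_iff.mpr hξ
  have hε0 := hε.1
  have h := h ⟨hε.1, hε.2.trans (min_le_left _ _)⟩ y hy ξ hξ
  rw [show m - α.length = -(-m + α.length) by ring, Real.rpow_neg hξ0.le,
    ← div_eq_mul_inv, le_div_iff₀ (by positivity), mul_comm, Real.rpow_natCast] at h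
  refine h.trans ?_
  gcongr
  linarith

theorem isSymb_normSq {Ω K : Set (Euc n)} (hΩ : IsOpen Ω) (hK : K ⊆ Ω) :
    IsSymb Ω (ModBd K) 2 (fun _ (z : Euc n × Euc p) => ‖z.2‖ ^ 2) := by
  have hB := isGrowth_modBd (p := p) hK
  have hcoord (j : Fin p) : IsSymb Ω (ModBd K) 1 (fun _ (z : Euc n × Euc p) => z.2 j) := by
    let ℓ : Euc n × Euc p →L[ℝ] ℝ :=
      (EuclideanSpace.proj j).comp (ContinuousLinearMap.snd ℝ (Euc n) (Euc p))
    have h0 : ModBd (p := p) K 1 (fun _ z => z.2 j) := by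
      refine ⟨0, 1, zero_le_one, .of_forall fun ε y _ ξ _ => ?_⟩
      simpa using PiLp.norm_apply_le ξ j
    refine ⟨fun _ _ => ℓ.contDiff.contDiffOn, fun k => ?_⟩
    cases k with
    | zero => exact h0
    | succ k =>
      refine ⟨h0, fun i => ?_⟩
      have hD : dirD (coordDir i) (fun z : Euc n × Euc p => z.2 j) =
          fun _ => ℓ (coordDir i) := by
        ext z
        exact congrArg (fun T : _ →L[ℝ] ℝ => T (coordDir i)) ℓ.fderiv
      simp only [hD]
      cases i with
      | inl i => simpa [coordDeg] using (IsSymb.const hK _).bound k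
      | inr i => simpa [ℓ, coordDir, eY] using DerBd.zero hB
  rw [← one_add_one_eq_two]
  refine (IsSymb.sum hΩ hB Finset.univ fun j _ =>
    (hcoord j).mul_mod hΩ hK (hcoord j)).congr hΩ hB fun ε _ z _ => ?_
  simp only [EuclideanSpace.real_norm_sq_eq, ← sq]

theorem isSymb_normSq_inv {Ω K : Set (Euc n)} (hΩ : IsOpen Ω) (hK : K ⊆ Ω) :
    IsSymb Ω (ModBd K) (-2) (fun _ (z : Euc n × Euc p) => (‖z.2‖ ^ 2)⁻¹) := by
  refine (isSymb_normSq hΩ hK).inv hΩ hK (fun ε _ z hz => ?_) ?_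
  · exact pow_ne_zero 2 (norm_ne_zero_iff.mpr hz.2)
  · refine ⟨0, 1, zero_le_one, .of_forall fun ε y _ ξ _ => ?_⟩
    rw [Real.rpow_neg (norm_nonneg _), abs_of_nonneg (by positivity)]
    simp

section Homogeneity

variable {Ω : Set (Euc n)} {f : Euc n × Euc p → ℝ}

theorem fderiv_dilation (hΩ : IsOpen Ω)
    (hf : ContDiffOn ℝ (⊤ : ℕ∞) f (puncturedDomain p Ω))
    (hom : ∀ y ∈ Ω, ∀ ξ : Euc p, ξ ≠ 0 → ∀ t : ℝ, 0 < t → f (y, t • ξ) = t * f (y, ξ))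
    {y : Euc n} (hy : y ∈ Ω) {ξ : Euc p} (hξ : ξ ≠ 0) {t : ℝ} (ht : 0 < t)
    (v : Euc n × Euc p) :
    fderiv ℝ f (y, t • ξ) (v.1, t • v.2) = t * fderiv ℝ f (y, ξ) v := by
  have hU := isOpen_puncturedDomain (p := p) hΩ
  let S : Euc n × Euc p →L[ℝ] Euc n × Euc p :=
    (ContinuousLinearMap.fst ℝ _ _).prod (t • ContinuousLinearMap.snd ℝ _ _)
  have hz : (y, ξ) ∈ puncturedDomain p Ω := mk_mem_prod hy hξ
  have htz : S (y, ξ) ∈ puncturedDomain p Ω := mk_mem_prod hy (smul_ne_zero ht.ne' hξ)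
  have h1 : HasFDerivAt (fun z => f (S z)) _ (y, ξ) :=
    (differentiableAt_of_contDiffOn hU hf htz).hasFDerivAt.comp (y, ξ) S.hasFDerivAt
  have h2 : HasFDerivAt (fun z => t * f z) _ (y, ξ) :=
    (differentiableAt_of_contDiffOn hU hf hz).hasFDerivAt.const_mul t
  have heq : EqOn (fun z => f (S z)) (fun z => t * f z) (puncturedDomain p Ω) :=
    fun z hz => hom z.1 hz.1 z.2 hz.2 t ht
  have h := congrArg (fun T : _ →L[ℝ] ℝ => T v)
    ((h1.congr_of_eventuallyEq (heq.eventuallyEq_of_mem (hU.mem_nhds hz)).symm).unique h2)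
  simpa [S] using h

theorem gradSq_normalized (hΩ : IsOpen Ω)
    (hf : ContDiffOn ℝ (⊤ : ℕ∞) f (puncturedDomain p Ω))
    (hom : ∀ y ∈ Ω, ∀ ξ : Euc p, ξ ≠ 0 → ∀ t : ℝ, 0 < t → f (y, t • ξ) = t * f (y, ξ))
    {z : Euc n × Euc p} (hz : z ∈ puncturedDomain p Ω) :
    gradSq f (z.1, ‖z.2‖⁻¹ • z.2) =
      (∑ k : Fin n, (‖z.2‖ ^ 2)⁻¹ * (dirD (eY k) f z * dirD (eY k) f z)) +
        ∑ j : Fin p, dirD (eXi j) f z * dirD (eXi j) f z := by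
  obtain ⟨y, ξ⟩ := z
  have hξ : 0 < ‖ξ‖⁻¹ := inv_pos.mpr (norm_pos_iff.mpr hz.2)
  have key := fderiv_dilation hΩ hf hom hz.1 hz.2 hξ
  have hY (k : Fin n) : dirD (eY k) f (y, ‖ξ‖⁻¹ • ξ) = ‖ξ‖⁻¹ * dirD (eY k) f (y, ξ) := by
    simpa [dirD, eY] using key (eY k)
  have hX (j : Fin p) : dirD (eXi j) f (y, ‖ξ‖⁻¹ • ξ) = dirD (eXi j) f (y, ξ) := by
    have h := key (eXi j)
    have hv : ((eXi j : Euc n × Euc p).1, ‖ξ‖⁻¹ • (eXi j : Euc n × Euc p).2) =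
        ‖ξ‖⁻¹ • (eXi j : Euc n × Euc p) := by
      simp [eXi]
    rw [hv, map_smul, smul_eq_mul] at h
    exact mul_left_cancel₀ hξ.ne' h
  simp only [gradSq, hY, hX]
  congr 1
  · exact Finset.sum_congr rfl fun k _ => by rw [mul_pow, inv_pow]; ring
  · exact Finset.sum_congr rfl fun j _ => sq _

end Homogeneity

/-- `|∇φ(y, ξ/|ξ|)|²` as a function of `(y, ξ)`. -/
def normGradSq (f : Euc n × Euc p → ℝ) (z : Euc n × Euc p) : ℝ :=
  gradSq f (z.1, ‖z.2‖⁻¹ • z.2)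

namespace MPhi

variable {Ω K : Set (Euc n)} {φ ω : ℝ → Euc n × Euc p → ℝ}

theorem smoothNet (hφ : MPhi Ω φ) : SmoothNet Ω φ := fun ε hε => (hφ.1 ε hε).1

theorem netEq_normGradSq (hΩ : IsOpen Ω) (hφ : MPhi Ω φ) :
    NetEq Ω (fun ε z => (∑ k : Fin n,
        (‖z.2‖ ^ 2)⁻¹ * (dirD (eY k) (φ ε) z * dirD (eY k) (φ ε) z)) +
          ∑ j : Fin p, dirD (eXi j) (φ ε) z * dirD (eXi j) (φ ε) z)
      (fun ε => normGradSq (φ ε)) :=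
  fun ε hε _ hz => (gradSq_normalized hΩ (hφ.1 ε hε).1 (hφ.1 ε hε).2.1 hz).symm

theorem isSymb_dirD_eXi (hΩ : IsOpen Ω) (hK : K ⊆ Ω) (hKc : IsCompact K) (hφ : MPhi Ω φ)
    (j : Fin p) : IsSymb Ω (ModBd K) 0 (fun ε => dirD (eXi j) (φ ε)) := by
  simpa [coordDeg, coordDir] using
    (isSymb_of_hgModerate hΩ hK hKc hφ.smoothNet hφ.2.1).dirD hΩ (.inl j)

theorem isSymb_dirD_eY (hΩ : IsOpen Ω) (hK : K ⊆ Ω) (hKc : IsCompact K) (hφ : MPhi Ω φ)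
    (k : Fin n) : IsSymb Ω (ModBd K) 1 (fun ε => dirD (eY k) (φ ε)) := by
  simpa [coordDeg, coordDir] using
    (isSymb_of_hgModerate hΩ hK hKc hφ.smoothNet hφ.2.1).dirD hΩ (.inr k)

theorem isSymb_normGradSq (hΩ : IsOpen Ω) (hK : K ⊆ Ω) (hKc : IsCompact K) (hφ : MPhi Ω φ) :
    IsSymb Ω (ModBd K) 0 (fun ε => normGradSq (φ ε)) := by
  have hB := isGrowth_modBd (p := p) hK
  refine IsSymb.congr hΩ hB (IsSymb.add hΩ hB (.sum hΩ hB _ fun k _ => ?_)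
    (.sum hΩ hB _ fun j _ => ?_)) (hφ.netEq_normGradSq hΩ)
  · have h := hφ.isSymb_dirD_eY hΩ hK hKc k
    convert (isSymb_normSq_inv hΩ hK).mul_mod hΩ hK (h.mul_mod hΩ hK h) using 1
    norm_num
  · have h := hφ.isSymb_dirD_eXi hΩ hK hKc j
    simpa only [add_zero] using h.mul_mod hΩ hK h

theorem normGradSq_ne_zero (hφ : MPhi Ω φ) {ε : ℝ} (hε : ε ∈ Ioc (0 : ℝ) 1)
    {z : Euc n × Euc p} (hz : z ∈ puncturedDomain p Ω) : normGradSq (φ ε) z ≠ 0 :=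
  (hφ.1 ε hε).2.2 z.1 hz.1 _
    (smul_ne_zero (inv_ne_zero (norm_ne_zero_iff.mpr hz.2)) hz.2)

theorem isSymb_varphiN (hΩ : IsOpen Ω) (hK : K ⊆ Ω) (hKc : IsCompact K) (hφ : MPhi Ω φ) :
    IsSymb Ω (ModBd K) 0 (fun ε => varphiN (φ ε)) := by
  have h := (hφ.isSymb_normGradSq hΩ hK hKc).inv hΩ hK
    (fun ε hε z hz => hφ.normGradSq_ne_zero hε hz) ?_
  · rwa [neg_zero] at h
  obtain ⟨r, hr, η, hη, h⟩ := hφ.2.2 K hK hKc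
  refine ⟨-r, 1, zero_le_one, ?_⟩
  filter_upwards [Ioc_mem_nhdsGT hη.1] with ε hε y hy ξ hξ
  have hpos : 0 < ε ^ r := Real.rpow_pos_of_pos hε.1 r
  have h := h ε hε y hy ξ hξ
  rw [neg_zero, Real.rpow_zero, mul_one, one_mul, Real.rpow_neg hε.1.le, abs_inv]
  exact inv_anti₀ hpos (h.trans (le_abs_self _))

theorem isSymb_dirD_sub (hΩ : IsOpen Ω) (hK : K ⊆ Ω) (hKc : IsCompact K) (hφ : MPhi Ω φ)
    (hω : MPhi Ω ω) (hdiff : HgNegligible Ω 1 (fun ε z => φ ε z - ω ε z))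
    (i : Fin p ⊕ Fin n) : IsSymb Ω (NegBd K) (1 - coordDeg i)
      (fun ε z => dirD (coordDir i) (φ ε) z - dirD (coordDir i) (ω ε) z) := by
  have hU := isOpen_puncturedDomain (p := p) hΩ
  have h := isSymb_of_hgNegligible hΩ hK hKc
    (fun ε hε => (hφ.smoothNet ε hε).sub (hω.smoothNet ε hε)) hdiff
  refine (h.dirD hΩ i).congr hΩ (isGrowth_negBd hK) fun ε hε z hz => ?_
  simp only [dirD]
  rw [fderiv_fun_sub (differentiableAt_of_contDiffOn hU (hφ.smoothNet ε hε) hz)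
    (differentiableAt_of_contDiffOn hU (hω.smoothNet ε hε) hz)]
  rfl

theorem isSymb_dirD_eXi_sub (hΩ : IsOpen Ω) (hK : K ⊆ Ω) (hKc : IsCompact K) (hφ : MPhi Ω φ)
    (hω : MPhi Ω ω) (hdiff : HgNegligible Ω 1 (fun ε z => φ ε z - ω ε z))
    (j : Fin p) :
    IsSymb Ω (NegBd K) 0 (fun ε z => dirD (eXi j) (φ ε) z - dirD (eXi j) (ω ε) z) := by
  simpa [coordDeg, coordDir] using isSymb_dirD_sub hΩ hK hKc hφ hω hdiff (.inl j)

theorem isSymb_dirD_eY_sub (hΩ : IsOpen Ω) (hK : K ⊆ Ω) (hKc : IsCompact K) (hφ : MPhi Ω φ)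
    (hω : MPhi Ω ω) (hdiff : HgNegligible Ω 1 (fun ε z => φ ε z - ω ε z))
    (k : Fin n) :
    IsSymb Ω (NegBd K) 1 (fun ε z => dirD (eY k) (φ ε) z - dirD (eY k) (ω ε) z) := by
  simpa [coordDeg, coordDir] using isSymb_dirD_sub hΩ hK hKc hφ hω hdiff (.inr k)

theorem isSymb_normGradSq_sub (hΩ : IsOpen Ω) (hK : K ⊆ Ω) (hKc : IsCompact K) (hφ : MPhi Ω φ)
    (hω : MPhi Ω ω) (hdiff : HgNegligible Ω 1 (fun ε z => φ ε z - ω ε z)) :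
    IsSymb Ω (NegBd K) 0 (fun ε z => normGradSq (φ ε) z - normGradSq (ω ε) z) := by
  have hM := isGrowth_modBd (p := p) hK
  have hN := isGrowth_negBd (p := p) hK
  have hY (k : Fin n) := (isSymb_dirD_eY_sub hΩ hK hKc hφ hω hdiff k).neg_mul_mod hΩ hK
    ((isSymb_normSq_inv hΩ hK).mul_mod hΩ hK
      ((hφ.isSymb_dirD_eY hΩ hK hKc k).add hΩ hM (hω.isSymb_dirD_eY hΩ hK hKc k)))
  have hX (j : Fin p) := (isSymb_dirD_eXi_sub hΩ hK hKc hφ hω hdiff j).neg_mul_mod hΩ hK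
    ((hφ.isSymb_dirD_eXi hΩ hK hKc j).add hΩ hM (hω.isSymb_dirD_eXi hΩ hK hKc j))
  norm_num only at hY hX
  refine ((IsSymb.sum hΩ hN Finset.univ fun k _ => hY k).add hΩ hN
    (.sum hΩ hN Finset.univ fun j _ => hX j)).congr hΩ hN fun ε hε z hz => ?_
  simp only [← hφ.netEq_normGradSq hΩ ε hε hz, ← hω.netEq_normGradSq hΩ ε hε hz]
  rw [add_sub_add_comm, ← Finset.sum_sub_distrib, ← Finset.sum_sub_distrib]
  congr 1 <;> exact Finset.sum_congr rfl fun _ _ => by ring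

theorem isSymb_mul_varphiN_sub (hΩ : IsOpen Ω) (hK : K ⊆ Ω) (hKc : IsCompact K) (hφ : MPhi Ω φ)
    (hω : MPhi Ω ω) (hdiff : HgNegligible Ω 1 (fun ε z => φ ε z - ω ε z))
    {m : ℝ} {a b : ℝ → Euc n × Euc p → ℝ} (hb : IsSymb Ω (ModBd K) m b)
    (hab : IsSymb Ω (NegBd K) m (fun ε z => a ε z - b ε z)) :
    IsSymb Ω (NegBd K) m
      (fun ε z => a ε z * varphiN (φ ε) z - b ε z * varphiN (ω ε) z) := by
  have hN := isGrowth_negBd (p := p) hK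
  have hφN := hφ.isSymb_varphiN hΩ hK hKc
  have hωN := hω.isSymb_varphiN hΩ hK hKc
  have h1 := hab.neg_mul_mod hΩ hK hφN
  have h2 := (isSymb_normGradSq_sub hΩ hK hKc hφ hω hdiff).neg_mul_mod hΩ hK
    ((IsSymb.const hK (-1)).mul_mod hΩ hK (hb.mul_mod hΩ hK (hφN.mul_mod hΩ hK hωN)))
  simp only [add_zero, zero_add] at h1 h2
  refine (h1.add hΩ hN h2).congr hΩ hN fun ε hε z hz => ?_
  have hφ0 := hφ.normGradSq_ne_zero hε hz
  have hω0 := hω.normGradSq_ne_zero hε hz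
  rw [show varphiN (φ ε) z = (normGradSq (φ ε) z)⁻¹ from rfl,
    show varphiN (ω ε) z = (normGradSq (ω ε) z)⁻¹ from rfl]
  field_simp
  ring

end MPhi

end SymbolNets

/-- technical lemma: if (φ_ε), (ω_ε) ∈ M_Φ(Ω×ℝ^p) with negligible difference,
then (∂_{ξ_j}φ_ε)φ_{φ_ε} − (∂_{ξ_j}ω_ε)φ_{ω_ε} is negligible in S^0_hg and
|ξ|⁻²((∂_{y_k}φ_ε)φ_{φ_ε} − (∂_{y_k}ω_ε)φ_{ω_ε}) is negligible in S^{-1}_hg. -/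
theorem stmt4 {n p : ℕ} (Ω : Set (Euc n)) (hΩ : IsOpen Ω)
    (φ ω : ℝ → Euc n × Euc p → ℝ) (hφ : MPhi Ω φ) (hω : MPhi Ω ω)
    (hdiff : HgNegligible Ω 1 (fun ε z => φ ε z - ω ε z)) :
    (∀ j : Fin p, HgNegligible Ω 0 (fun ε z =>
      dirD (eXi j) (φ ε) z * varphiN (φ ε) z - dirD (eXi j) (ω ε) z * varphiN (ω ε) z)) ∧
    (∀ k : Fin n, HgNegligible Ω (-1) (fun ε z =>
      (‖z.2‖ ^ 2)⁻¹ *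
        (dirD (eY k) (φ ε) z * varphiN (φ ε) z - dirD (eY k) (ω ε) z * varphiN (ω ε) z))) := by
  refine ⟨fun j => hgNegligible_of_isSymb fun K hK hKc => ?_,
    fun k => hgNegligible_of_isSymb fun K hK hKc => ?_⟩
  · exact MPhi.isSymb_mul_varphiN_sub hΩ hK hKc hφ hω hdiff (hω.isSymb_dirD_eXi hΩ hK hKc j)
      (MPhi.isSymb_dirD_eXi_sub hΩ hK hKc hφ hω hdiff j)
  · have h := (MPhi.isSymb_mul_varphiN_sub hΩ hK hKc hφ hω hdiff
      (hω.isSymb_dirD_eY hΩ hK hKc k)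
      (MPhi.isSymb_dirD_eY_sub hΩ hK hKc hφ hω hdiff k)).neg_mul_mod hΩ hK
      (isSymb_normSq_inv hΩ hK)
    norm_num only at h
    exact h.congr hΩ (isGrowth_negBd hK) fun ε _ z _ => mul_comm _ _
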